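/- arXiv:nlin/0205063 — 2 statements merged into one kernel-verified Lean document; each statement's English description precedes it below -/
import Mathlib

section
/- Fix an integer N and elements y, z ∈ K with z ≠ 0. For w ∈ K define F0(w) = q^N · φ_{N−1}(y,w) · φ_N(y/q,w) / (φ_{N−1}(y/q,w) · φ_N(y,w)) and F1(w) = φ_{N−1}(y/q,w/q) · φ_N(y,w) / (φ_{N−1}(y,w) · φ_N(y/q,w/q)). Assume that φ_{N−1} and φ_N are both nonzero at each of the five argument pairs (y,z), (y/q,z), (y,z/q), (y/q,z/q), (y,qz), and that z + F0(z) ≠ 0 and 1 + (y/z)·F1(z) ≠ 0. Then the q-Painlevé III system with c = q^N holds: F1(qz) = (q^{2N} / (F0(z)·F1(z))) · (1 + z·F0(z)) / (z + F0(z)), and F0(z/q) = (q^{2N} / (F0(z)·F1(z))) · ((y/z) + F1(z)) / (1 + (y/z)·F1(z)). -/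
open Matrix Finset

/-- The Jacobi--Trudi type determinant: `det (p (n - 2i + j) y z)_{0 ≤ i,j ≤ n-1}`. -/
noncomputable def phiAux {K : Type*} [Field K] (p : ℤ → K → K → K) (n : ℕ) (y z : K) : K :=
  Matrix.det (Matrix.of fun i j : Fin n => p ((n : ℤ) - 2 * ((i : ℕ) : ℤ) + ((j : ℕ) : ℤ)) y z)

/-- The polynomials `φ_N(y,z)`: for `N ≥ 0` the Jacobi--Trudi determinant (with `φ_0 = 1`
as the empty determinant), and for `N < 0` we set `φ_N = (-1)^(N(N+1)/2) φ_(-N-1)`. -/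
noncomputable def phi {K : Type*} [Field K] (p : ℤ → K → K → K) (N : ℤ) (y z : K) : K :=
  if 0 ≤ N then phiAux p N.toNat y z
  else (-1 : K) ^ (N * (N + 1) / 2) * phiAux p (-N - 1).toNat y z

/-- The staircase Jacobi--Trudi determinant attached to a sequence `h`. -/
def staircaseDet {R : Type*} [CommRing R] (n : ℕ) (h : ℤ → R) : R :=
  Matrix.det (Matrix.of fun i j : Fin n => h ((n : ℤ) - 2 * ((i : ℕ) : ℤ) + ((j : ℕ) : ℤ)))

/-- Multiplication of the generating function of `h` by `1 - a t`. -/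
def seqShift {R : Type*} [CommRing R] (a : R) (h : ℤ → R) : ℤ → R :=
  fun k => h k - a * h (k - 1)

section Plucker

variable {R : Type*} [CommRing R]

/-- Three-term Plücker relation. -/
theorem det_plucker {n : ℕ} (M : Fin n → Fin (n + 2) → R) (a b c d : Fin (n + 2) → R) :
    det (of (vecCons a (vecCons b M))) * det (of (vecCons c (vecCons d M)))
      - det (of (vecCons a (vecCons c M))) * det (of (vecCons b (vecCons d M)))
      + det (of (vecCons a (vecCons d M))) * det (of (vecCons b (vecCons c M))) = 0 := by
  let L : (Fin (n + 2) → R) → R := fun v => det (of (vecCons a (vecCons v M)))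
  have hL : ∃ w : Fin (n + 2) → R, ∀ v, L v = ∑ k, w k * v k := by
    refine ⟨fun k => (-1) ^ ((1 : ℕ) + (k : ℕ)) *
      det (of fun (i : Fin (n + 1)) j => vecCons a M i (k.succAbove j)), fun v => ?_⟩
    simp only [L]
    rw [det_succ_row _ 1]
    refine Finset.sum_congr rfl fun k _ => ?_
    have : (of (vecCons a (vecCons v M))).submatrix (Fin.succAbove 1) k.succAbove
        = of fun (i : Fin (n + 1)) j => vecCons a M i (k.succAbove j) := by
      ext i j
      refine Fin.cases ?_ (fun i => ?_) i
      · simp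
      · simp [Fin.succAbove_of_le_castSucc, Fin.le_def]
    rw [this]
    simp
    ring
  obtain ⟨w, hw⟩ := hL
  let V : Fin (n + 3) → Fin (n + 2) → R := vecCons b (vecCons c (vecCons d M))
  let B : Matrix (Fin (n + 3)) (Fin (n + 3)) R := of fun i => vecCons (L (V i)) (V i)
  have hB : det B = 0 := by
    have h1 : B = B.updateCol 0 (fun i => ∑ k : Fin (n + 2), w k * B i k.succ) := by
      ext i j
      refine Fin.cases ?_ (fun j => ?_) j
      · simp [B, hw]
      · simp [B]
    have h2 := det_updateCol_sum B 0 (vecCons 0 w)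
    rw [h1]
    simpa [Fin.sum_univ_succ (n := n + 2)] using h2
  rw [det_succ_column_zero, Fin.sum_univ_succ, Fin.sum_univ_succ, Fin.sum_univ_succ] at hB
  have hM : ∀ i, L (M i) = 0 := by
    intro i
    refine det_zero_of_row_eq (i := 1) (j := i.succ.succ) ?_ ?_
    · simp [Fin.ext_iff]
    · ext j; simp
  have e0 : B.submatrix (Fin.succAbove 0) Fin.succ = of (vecCons c (vecCons d M)) := by
    ext i j
    simp [B, V]
  have e1 : B.submatrix (Fin.succAbove (Fin.succ 0)) Fin.succ = of (vecCons b (vecCons d M)) := by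
    ext i j
    refine Fin.cases ?_ (fun i => ?_) i <;> simp [B, V]
  have e2 : B.submatrix (Fin.succAbove (Fin.succ (Fin.succ 0))) Fin.succ
      = of (vecCons b (vecCons c M)) := by
    ext i j
    refine Fin.cases ?_ (fun i => ?_) i
    · simp only [B, V, submatrix_apply, of_apply, Fin.succ_succAbove_zero, cons_val_succ,
        cons_val_zero]
    · refine Fin.cases ?_ (fun i => ?_) i <;>
      simp only [B, V, submatrix_apply, of_apply, Fin.succ_succAbove_zero,
        Fin.succ_succAbove_succ, Fin.zero_succAbove, cons_val_succ, cons_val_zero]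
  have hv : ((Fin.succ (Fin.succ 0) : Fin (n + 3)) : ℕ) = 2 := rfl
  rw [e0, e1, e2, hv] at hB
  simp [B, V, hM] at hB
  simp only [L] at hB
  linear_combination hB

theorem det_vecCons_single {n : ℕ} (M : Fin n → Fin (n + 1) → R) :
    det (of (vecCons (Pi.single 0 1) M)) = det (of fun i j => M i (Fin.succ j)) := by
  rw [det_succ_row_zero, Fin.sum_univ_succ]
  simp
  rfl

theorem det_vecCons_smul {n : ℕ} (a : R) (u : Fin (n + 1) → R) (M : Fin n → Fin (n + 1) → R) :
    det (of (vecCons (a • u) M)) = a * det (of (vecCons u M)) := by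
  rw [det_succ_row_zero, det_succ_row_zero, Finset.mul_sum]
  refine Finset.sum_congr rfl fun j _ => ?_
  have : (of (vecCons (a • u) M)).submatrix Fin.succ j.succAbove
      = (of (vecCons u M)).submatrix Fin.succ j.succAbove := by
    ext; simp
  rw [this]
  simp
  ring

theorem det_vecCons_pow {n : ℕ} (a : R) (M : Fin n → Fin (n + 1) → R) :
    det (of (vecCons (fun j => a ^ (j : ℕ)) M))
      = det (of fun i (j : Fin n) => M i j.succ - a * M i j.castSucc) := by
  have h := det_vecCons_single
    fun i => (vecCons (M i 0) fun j => M i j.succ - a * M i j.castSucc : Fin (n + 1) → R)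
  simp only [cons_val_succ] at h
  rw [← h]
  refine (det_eq_of_forall_col_eq_smul_add_pred (fun _ => a) ?_ ?_)
  · intro i
    refine Fin.cases ?_ (fun i => ?_) i <;> simp
  · intro i j
    refine Fin.cases ?_ (fun i => ?_) i
    · simp [pow_succ]; ring
    · simp

theorem staircaseDet_plucker (n : ℕ) (h : ℤ → R) (a b : R) :
    (a - b) * (staircaseDet n (seqShift a (seqShift b h)) * staircaseDet (n + 1) h)
      = a * (staircaseDet n (seqShift a h) * staircaseDet (n + 1) (seqShift b h))
        - b * (staircaseDet n (seqShift b h) * staircaseDet (n + 1) (seqShift a h)) := by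
  let M : Fin n → Fin (n + 2) → R := fun i j => h ((n : ℤ) - 2 - 2 * ((i : ℕ) : ℤ) + ((j : ℕ) : ℤ))
  let r : Fin (n + 2) → R := fun j => h ((n : ℤ) + ((j : ℕ) : ℤ))
  let e : Fin (n + 2) → R := Pi.single 0 1
  let v : R → Fin (n + 2) → R := fun a j => a ^ (j : ℕ)
  have her : det (of (vecCons e (vecCons r M))) = staircaseDet (n + 1) h := by
    simp only [e]
    rw [det_vecCons_single]
    unfold staircaseDet
    congr 1
    ext i j
    refine Fin.cases ?_ (fun i => ?_) i
    · simp [r]; ring_nf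
    · simp [M]; ring_nf
  have hvr : ∀ a, det (of (vecCons (v a) (vecCons r M))) = staircaseDet (n + 1) (seqShift a h) := by
    intro a
    simp only [v]
    rw [det_vecCons_pow]
    unfold staircaseDet seqShift
    congr 1
    ext i j
    refine Fin.cases ?_ (fun i => ?_) i
    · simp [r]; ring_nf
    · simp [M]; ring_nf
  have hev : ∀ a, det (of (vecCons e (vecCons (v a) M))) = a * staircaseDet n (seqShift a h) := by
    intro a
    simp only [e]
    rw [det_vecCons_single]
    have : (of fun i j => vecCons (v a) M i (Fin.succ j))
        = of (vecCons (a • fun j : Fin (n + 1) => a ^ (j : ℕ)) fun i (j : Fin (n + 1)) =>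
            M i j.succ) := by
      ext i j
      refine Fin.cases ?_ (fun i => ?_) i
      · simp [v, pow_succ, mul_comm]
      · simp
    rw [this, det_vecCons_smul, det_vecCons_pow]
    unfold staircaseDet seqShift
    congr 2
    ext i j
    simp [M]; ring_nf
  have hvv : det (of (vecCons (v a) (vecCons (v b) M)))
      = (b - a) * staircaseDet n (seqShift a (seqShift b h)) := by
    simp only [v]
    rw [det_vecCons_pow]
    have : (of fun i (j : Fin (n + 1)) =>
          vecCons (fun j : Fin (n + 2) => b ^ (j : ℕ)) M i j.succ
            - a * vecCons (fun j : Fin (n + 2) => b ^ (j : ℕ)) M i j.castSucc)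
        = of (vecCons ((b - a) • fun j : Fin (n + 1) => b ^ (j : ℕ)) fun i (j : Fin (n + 1)) =>
            M i j.succ - a * M i j.castSucc) := by
      ext i j
      refine Fin.cases ?_ (fun i => ?_) i
      · simp [pow_succ]; ring
      · simp
    rw [this, det_vecCons_smul, det_vecCons_pow]
    unfold staircaseDet seqShift
    congr 2
    ext i j
    simp [M]; ring_nf
  have key := det_plucker M e (v a) (v b) r
  rw [her, hvr, hvr, hev, hev, hvv] at key
  linear_combination -key
end Plucker

section Duality

variable {R : Type*} [CommRing R]

/-- The coefficients of a power series, extended by zero to negative indices. -/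
noncomputable def extCoeff (f : PowerSeries R) : ℤ → R :=
  fun k => if k < 0 then 0 else PowerSeries.coeff k.toNat f

theorem extCoeff_of_neg (f : PowerSeries R) {k : ℤ} (hk : k < 0) : extCoeff f k = 0 :=
  if_pos hk

theorem extCoeff_natCast (f : PowerSeries R) (k : ℕ) :
    extCoeff f (k : ℤ) = PowerSeries.coeff k f := by
  simp [extCoeff]

theorem seqShift_extCoeff (a : R) (f : PowerSeries R) :
    seqShift a (extCoeff f) = extCoeff ((1 - PowerSeries.C a * PowerSeries.X) * f) := by
  ext k
  unfold seqShift
  rcases lt_or_ge k 0 with hk | hk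
  · rw [extCoeff_of_neg _ hk, extCoeff_of_neg _ hk, extCoeff_of_neg _ (by omega)]
    simp
  · lift k to ℕ using hk
    rw [sub_mul, one_mul, mul_assoc, extCoeff_natCast, extCoeff_natCast, map_sub,
      PowerSeries.coeff_C_mul]
    cases k with
    | zero => rw [extCoeff_of_neg _ (by simp)]; simp
    | succ k =>
      rw [PowerSeries.coeff_succ_X_mul, show ((k + 1 : ℕ) : ℤ) - 1 = (k : ℤ) by simp,
        extCoeff_natCast]

theorem sum_extCoeff_mul (f g : PowerSeries R) {m s : ℕ} (r : ℕ) (hs : s < m) :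
    ∑ k ∈ range m, extCoeff f ((k : ℤ) - r) * extCoeff g ((s : ℤ) - k)
      = extCoeff (f * g) ((s : ℤ) - r) := by
  rcases lt_or_ge s r with h | h
  · rw [extCoeff_of_neg _ (by omega)]
    refine Finset.sum_eq_zero fun k _ => ?_
    rcases lt_or_ge k r with hk | hk
    · rw [extCoeff_of_neg _ (by omega), zero_mul]
    · rw [extCoeff_of_neg g (by omega), mul_zero]
  · obtain ⟨d, rfl⟩ := Nat.exists_eq_add_of_le h
    rw [show ((r + d : ℕ) : ℤ) - r = (d : ℤ) by simp, extCoeff_natCast, PowerSeries.coeff_mul,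
      Finset.Nat.sum_antidiagonal_eq_sum_range_succ
        (fun i j => PowerSeries.coeff i f * PowerSeries.coeff j g),
      ← Finset.sum_subset (s₁ := Finset.Ico r (r + d + 1))]
    · rw [Finset.sum_Ico_eq_sum_range, show r + d + 1 - r = d.succ by omega]
      refine Finset.sum_congr rfl fun i hi => ?_
      have hi' : i ≤ d := by simpa [Nat.lt_succ_iff] using hi
      rw [show ((r + i : ℕ) : ℤ) - r = (i : ℤ) by simp, extCoeff_natCast,
        show ((r + d : ℕ) : ℤ) - (r + i : ℕ) = ((d - i : ℕ) : ℤ) by omega, extCoeff_natCast]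
    · intro k hk
      simp at hk ⊢
      omega
    · intro k _ hk
      simp only [Finset.mem_Ico, not_and_or] at hk
      rcases hk with hk | hk
      · rw [extCoeff_of_neg _ (by omega), zero_mul]
      · rw [extCoeff_of_neg g (by omega), mul_zero]

theorem det_toBlocks₁₁_of_mul_eq_one {m n : Type*} [Fintype m] [Fintype n] [DecidableEq m]
    [DecidableEq n] (M M' : Matrix (m ⊕ n) (m ⊕ n) R) (h : M * M' = 1) :
    det M.toBlocks₁₁ = det M * det M'.toBlocks₂₂ := by
  have h' : fromBlocks M.toBlocks₁₁ M.toBlocks₁₂ M.toBlocks₂₁ M.toBlocks₂₂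
      * fromBlocks M'.toBlocks₁₁ M'.toBlocks₁₂ M'.toBlocks₂₁ M'.toBlocks₂₂
      = fromBlocks 1 0 0 1 := by
    rw [fromBlocks_toBlocks, fromBlocks_toBlocks, h, fromBlocks_one]
  rw [fromBlocks_multiply, fromBlocks_inj] at h'
  obtain ⟨-, h12, -, h22⟩ := h'
  have key : M * fromBlocks 1 M'.toBlocks₁₂ 0 M'.toBlocks₂₂
      = fromBlocks M.toBlocks₁₁ 0 M.toBlocks₂₁ 1 := by
    conv_lhs => rw [← fromBlocks_toBlocks M]
    rw [fromBlocks_multiply, h12, h22]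
    simp
  have := congrArg det key
  rw [det_mul, det_fromBlocks_zero₂₁, det_fromBlocks_zero₁₂] at this
  simpa using this.symm

/-- `Fin n ⊕ Fin n` enumerated as even and odd numbers. -/
theorem exists_parityEquiv (n : ℕ) : ∃ e : Fin n ⊕ Fin n ≃ Fin (n + n),
    (∀ i, (e (Sum.inl i) : ℕ) = 2 * i) ∧ ∀ i, (e (Sum.inr i) : ℕ) = 2 * i + 1 := by
  let e : Fin n ⊕ Fin n → Fin (n + n) :=
    Sum.elim (fun i => ⟨2 * i, by omega⟩) (fun i => ⟨2 * i + 1, by omega⟩)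
  have he : Function.Bijective e := by
    rw [Fintype.bijective_iff_injective_and_card]
    refine ⟨?_, by simp⟩
    rintro (i | i) (j | j) h <;> simp [e, Fin.ext_iff] at h ⊢ <;> omega
  exact ⟨Equiv.ofBijective e he, fun _ => rfl, fun _ => rfl⟩

theorem exists_staircaseDet_dual (n : ℕ) : ∃ ε : R, ε * ε = 1 ∧ ∀ f g : PowerSeries R,
    PowerSeries.constantCoeff f = 1 → f * g = 1 →
      staircaseDet n (extCoeff f) = ε * staircaseDet n (extCoeff g) := by
  obtain ⟨e, he1, he2⟩ := exists_parityEquiv n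
  let c : Fin n ⊕ Fin n ≃ Fin (n + n) := (Equiv.sumComm _ _).trans finSumFinEquiv
  let σ : Equiv.Perm (Fin n ⊕ Fin n) := c.trans e.symm
  refine ⟨((Equiv.Perm.sign σ : ℤ) : R), ?_, fun f g hf hfg => ?_⟩
  · rw [← Int.cast_mul, ← Units.val_mul, Int.units_mul_self]; simp
  let U : Matrix (Fin (n + n)) (Fin (n + n)) R := of fun i j => extCoeff f ((j : ℤ) - (i : ℤ))
  let V : Matrix (Fin (n + n)) (Fin (n + n)) R := of fun i j => extCoeff g ((j : ℤ) - (i : ℤ))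
  have hUV : U * V = 1 := by
    ext i j
    rw [mul_apply]
    simp only [U, V, of_apply]
    rw [Fin.sum_univ_eq_sum_range
      (fun k => extCoeff f ((k : ℤ) - (i : ℕ)) * extCoeff g (((j : ℕ) : ℤ) - k)),
      sum_extCoeff_mul _ _ _ j.2, hfg, one_apply]
    unfold extCoeff
    split_ifs with h1 h2 h2
    · subst h2; simp at h1
    · rfl
    · subst h2; simp
    · rw [PowerSeries.coeff_one, if_neg]
      simp only [Fin.ext_iff] at h2
      omega
  have hU : det U = 1 := by
    rw [det_of_isUpperTriangular]
    · refine Finset.prod_eq_one fun i _ => ?_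
      simp [U, extCoeff, hf]
    · intro i j hij
      exact extCoeff_of_neg _ (by simpa using hij)
  have hM : det (U.submatrix e c) = ((Equiv.Perm.sign σ : ℤ) : R) := by
    have : U.submatrix e c = (U.submatrix e e).submatrix id σ := by
      ext; simp [σ]
    rw [this, det_permute', det_submatrix_equiv_self, hU, mul_one]
  have hMM : U.submatrix e c * V.submatrix c e = 1 := by
    rw [submatrix_mul_equiv, hUV, submatrix_one_equiv]
  have key := det_toBlocks₁₁_of_mul_eq_one _ _ hMM
  rw [hM] at key
  convert key using 2
  · unfold staircaseDet
    congr 1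
    ext i j
    simp [toBlocks₁₁, U, c, he1]
    ring_nf
  · unfold staircaseDet
    rw [← det_transpose, ← det_submatrix_equiv_self Fin.revPerm]
    congr 1
    ext i j
    simp only [toBlocks₂₂, V, c, he2, of_apply, submatrix_apply, transpose_apply, Fin.revPerm_apply,
      Equiv.trans_apply, Equiv.sumComm_apply, Sum.swap_inr, finSumFinEquiv_apply_left,
      Fin.val_castAdd, Fin.val_rev]
    congr 1
    omega

theorem staircaseDet_plucker_dual (n : ℕ) (h : ℤ → R) (hneg : ∀ k < 0, h k = 0) (h0 : h 0 = 1)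
    (a b : R) :
    (a - b) * (staircaseDet n h * staircaseDet (n + 1) (seqShift a (seqShift b h)))
      = a * (staircaseDet n (seqShift b h) * staircaseDet (n + 1) (seqShift a h))
        - b * (staircaseDet n (seqShift a h) * staircaseDet (n + 1) (seqShift b h)) := by
  let f : PowerSeries R := PowerSeries.mk fun k => h k
  have hf : h = extCoeff f := by
    ext k
    rcases lt_or_ge k 0 with hk | hk
    · rw [hneg k hk, extCoeff_of_neg _ hk]
    · lift k to ℕ using hk
      simp [extCoeff_natCast, f]
  have hf0 : PowerSeries.constantCoeff f = 1 := by
    rw [← PowerSeries.coeff_zero_eq_constantCoeff_apply]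
    simp [f, h0]
  let A : PowerSeries R := 1 - PowerSeries.C a * PowerSeries.X
  let B : PowerSeries R := 1 - PowerSeries.C b * PowerSeries.X
  have hA : PowerSeries.constantCoeff A = 1 := by simp [A]
  have hB : PowerSeries.constantCoeff B = 1 := by simp [B]
  obtain ⟨g, hg⟩ : ∃ g, A * (B * f) * g = 1 := by
    have : IsUnit (A * (B * f)) := by
      rw [PowerSeries.isUnit_iff_constantCoeff]
      simp [hA, hB, hf0]
    exact this.exists_right_inv
  have key := staircaseDet_plucker n (extCoeff g) a b
  simp only [seqShift_extCoeff] at key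
  rw [hf]
  simp only [seqShift_extCoeff]
  obtain ⟨ε, hε, hd⟩ := exists_staircaseDet_dual (R := R) n
  obtain ⟨δ, hδ, hd'⟩ := exists_staircaseDet_dual (R := R) (n + 1)
  have hBf : PowerSeries.constantCoeff (B * f) = 1 := by simp [hB, hf0]
  have hAf : PowerSeries.constantCoeff (A * f) = 1 := by simp [hA, hf0]
  have hABf : PowerSeries.constantCoeff (A * (B * f)) = 1 := by simp [hA, hBf]
  rw [hd f (A * (B * g)) hf0 (by linear_combination hg), hd' (A * (B * f)) g hABf hg,
    hd (B * f) (A * g) hBf (by linear_combination hg),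
    hd' (A * f) (B * g) hAf (by linear_combination hg),
    hd (A * f) (B * g) hAf (by linear_combination hg),
    hd' (B * f) (A * g) hBf (by linear_combination hg)]
  linear_combination ε * δ * key

end Duality

section Symmetric

variable {R S : Type*} [CommRing R] [CommRing S]

theorem map_staircaseDet (φ : R →+* S) (n : ℕ) (h : ℤ → R) :
    φ (staircaseDet n h) = staircaseDet n fun k => φ (h k) := by
  unfold staircaseDet
  rw [RingHom.map_det]
  rfl

theorem map_seqShift (φ : R →+* S) (a : R) (h : ℤ → R) :
    (fun k => φ (seqShift a h k)) = seqShift (φ a) fun k => φ (h k) := by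
  ext k
  simp [seqShift]

theorem staircaseDet_symm_plucker_of_ne [IsDomain R] (n : ℕ) (h : ℤ → R)
    (hneg : ∀ k < 0, h k = 0) (h0 : h 0 = 1) {a b : R} (hab : a ≠ b) :
    a * (staircaseDet n (seqShift a (seqShift b h)) * staircaseDet (n + 1) h)
        + b * (staircaseDet n h * staircaseDet (n + 1) (seqShift a (seqShift b h)))
      = (a + b) * (staircaseDet n (seqShift a h) * staircaseDet (n + 1) (seqShift b h)) := by
  refine mul_left_cancel₀ (sub_ne_zero.mpr hab) ?_
  linear_combination a * staircaseDet_plucker n h a b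
    + b * staircaseDet_plucker_dual n h hneg h0 a b

theorem staircaseDet_symm_plucker [IsDomain R] (n : ℕ) (h : ℤ → R)
    (hneg : ∀ k < 0, h k = 0) (h0 : h 0 = 1) (a b : R) :
    a * (staircaseDet n (seqShift a (seqShift b h)) * staircaseDet (n + 1) h)
        + b * (staircaseDet n h * staircaseDet (n + 1) (seqShift a (seqShift b h)))
      = (a + b) * (staircaseDet n (seqShift a h) * staircaseDet (n + 1) (seqShift b h)) := by
  have hne : (Polynomial.C a : Polynomial R) ≠ Polynomial.C b + Polynomial.X := by
    intro h
    simpa using congrArg (fun p => Polynomial.coeff p 1) h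
  have key := congrArg (Polynomial.evalRingHom (0 : R)) <|
    staircaseDet_symm_plucker_of_ne n (fun k => Polynomial.C (h k))
      (fun k hk => by simp [hneg k hk]) (by simp [h0]) hne
  simp only [map_add, map_mul, map_staircaseDet, map_seqShift] at key
  simpa using key

end Symmetric

section Bilinear

variable {K : Type*} [Field K]

/-- The bilinear q-difference equations relating two consecutive members `A`, `B` of the family
`φ_N`, with parameter `c = q ^ N`. -/
def BilinearRel (q c : K) (A B : K → K → K) (y z : K) : Prop :=
  A (y / q) z * B y z + z * c * (A y z * B (y / q) z)
      = (1 + z) * (A (y / q) (z / q) * B y (q * z)) ∧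
    z * (A (y / q) z * B y z) + c * (A y z * B (y / q) z)
      = c * (1 + z) * (A y (q * z) * B (y / q) (z / q)) ∧
    y * (A y z * B (y / q) (z / q)) + z * (A (y / q) (z / q) * B y z)
      = (y + z) * (A y (z / q) * B (y / q) z) ∧
    z * (A y z * B (y / q) (z / q)) + y * (A (y / q) (z / q) * B y z)
      = (y + z) * (A (y / q) z * B y (z / q))

theorem BilinearRel.swap {q c : K} {A B : K → K → K} {y z : K} (hc : c ≠ 0)
    (h : BilinearRel q c A B y z) : BilinearRel q c⁻¹ B A y z := by
  obtain ⟨h1, h2, h3, h4⟩ := h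
  have hcc : c⁻¹ * c = 1 := inv_mul_cancel₀ hc
  refine ⟨?_, ?_, ?_, ?_⟩
  · linear_combination c⁻¹ * h2 + (-(A y z * B (y / q) z) +
      (1 + z) * (A y (q * z) * B (y / q) (z / q))) * hcc
  · linear_combination c⁻¹ * h1 - z * (A y z * B (y / q) z) * hcc
  · linear_combination h4
  · linear_combination h3

theorem BilinearRel.smul {q c : K} {A B : K → K → K} {y z : K} (s t : K)
    (h : BilinearRel q c A B y z) :
    BilinearRel q c (fun y z => s * A y z) (fun y z => t * B y z) y z := by
  obtain ⟨h1, h2, h3, h4⟩ := h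
  refine ⟨?_, ?_, ?_, ?_⟩
  · linear_combination s * t * h1
  · linear_combination s * t * h2
  · linear_combination s * t * h3
  · linear_combination s * t * h4

theorem staircaseDet_zpow_mul {q : K} (hq0 : q ≠ 0) (n : ℕ) (h : ℤ → K) :
    staircaseDet n (fun k => q ^ k * h k)
      = (∏ i ∈ range n, q ^ (n - i)) * staircaseDet n h := by
  have hfac : (of fun i j : Fin n =>
        q ^ ((n : ℤ) - 2 * ((i : ℕ) : ℤ) + ((j : ℕ) : ℤ)) *
          h ((n : ℤ) - 2 * ((i : ℕ) : ℤ) + ((j : ℕ) : ℤ)))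
      = of fun i j : Fin n => q ^ ((n : ℤ) - 2 * ((i : ℕ) : ℤ)) *
          (of fun i j : Fin n => q ^ ((j : ℕ) : ℤ) *
            (of fun i j : Fin n => h ((n : ℤ) - 2 * ((i : ℕ) : ℤ) + ((j : ℕ) : ℤ))) i j) i j := by
    ext i j
    simp only [of_apply]
    rw [zpow_add₀ hq0, mul_assoc]
  unfold staircaseDet
  rw [hfac, det_mul_column, det_mul_row, ← mul_assoc, ← Finset.prod_mul_distrib,
    ← Fin.prod_univ_eq_prod_range]
  congr 1
  refine Finset.prod_congr rfl fun i _ => ?_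
  rw [← zpow_add₀ hq0, ← zpow_natCast]
  congr 1
  omega

theorem bilinearRel_phiAux (q : K) (hq0 : q ≠ 0) (hq1 : q ≠ 1) (p : ℤ → K → K → K)
    (hp_neg : ∀ k : ℤ, k < 0 → ∀ y z : K, p k y z = 0)
    (hp_zero : ∀ y z : K, p 0 y z = 1)
    (hC1 : ∀ k : ℕ, 1 ≤ k → ∀ y z : K,
      (∑ i ∈ Finset.range k, q ^ i) * p (k : ℤ) y z
        = (y + z + q ^ (k - 1)) * p ((k : ℤ) - 1) y z
          - (1 - q) * y * z * p ((k : ℤ) - 2) y z)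
    (hC2 : ∀ (k : ℤ) (y z : K), p k y (q * z) - p k y z = (q - 1) * z * p (k - 1) y z)
    (hC3 : ∀ (k : ℤ) (y z : K), p k (q * y) z - p k y z = (q - 1) * y * p (k - 1) y z)
    (n : ℕ) (y z : K) :
    BilinearRel q (q ^ (n + 1)) (phiAux p n) (phiAux p (n + 1)) y z := by
  obtain ⟨u, rfl⟩ : ∃ u, y = q * u := ⟨y / q, by field_simp⟩
  obtain ⟨v, rfl⟩ : ∃ v, z = q * v := ⟨z / q, by field_simp⟩
  unfold BilinearRel
  rw [mul_div_cancel_left₀ _ hq0, mul_div_cancel_left₀ _ hq0]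
  have hphi : ∀ m y z, phiAux p m y z = staircaseDet m fun k => p k y z := fun _ _ _ => rfl
  simp only [hphi]
  let b : ℤ → K := fun k => p k u v
  let α : K := (1 - q) * u
  let β : K := (1 - q) * v
  let γ : K := -(1 - q) / q
  have hb : (fun k => p k u v) = b := rfl
  have hβ : (fun k => p k u (q * v)) = seqShift β b := by
    ext k
    simp only [seqShift, b, β]
    linear_combination hC2 k u v
  have hα : (fun k => p k (q * u) v) = seqShift α b := by
    ext k
    simp only [seqShift, b, α]
    linear_combination hC3 k u v
  have hαβ : (fun k => p k (q * u) (q * v)) = seqShift α (seqShift β b) := by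
    rw [← hβ]
    ext k
    simp only [seqShift, α]
    linear_combination hC3 k u (q * v)
  have hγ : (fun k => p k (q * u) (q * v)) = fun k => q ^ k * seqShift γ b k := by
    rw [hαβ]
    ext k
    simp only [seqShift, α, β, γ, b]
    rcases lt_or_ge k 0 with hk | hk
    · rw [hp_neg _ hk, hp_neg (k - 1) (by omega), hp_neg (k - 1 - 1) (by omega)]
      simp
    · lift k to ℕ using hk
      rcases Nat.eq_zero_or_pos k with rfl | hk
      · simp [hp_zero, hp_neg]
      · have hC := hC1 k hk u v
        have hg := mul_neg_geom_sum q k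
        obtain ⟨m, rfl⟩ : ∃ m, k = m + 1 := ⟨k - 1, by omega⟩
        rw [show ((m + 1 : ℕ) : ℤ) - 1 - 1 = ((m + 1 : ℕ) : ℤ) - 2 by ring, zpow_natCast]
        rw [Nat.add_sub_cancel] at hC
        have hγ' : q ^ (m + 1) * (-(1 - q) / q) = -(1 - q) * q ^ m := by
          rw [pow_succ]
          field_simp
        linear_combination (1 - q) * hC - p ((m + 1 : ℕ) : ℤ) u v * hg
          + p (((m + 1 : ℕ) : ℤ) - 1) u v * hγ'
  have hγβ : (fun k => p k (q * u) (q * (q * v)))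
      = fun k => q ^ k * seqShift γ (seqShift β b) k := by
    have h1 : (fun k => p k (q * u) (q * (q * v)))
        = fun k => p k (q * u) (q * v) - q * β * p (k - 1) (q * u) (q * v) := by
      ext k
      simp only [β]
      linear_combination hC2 k (q * u) (q * v)
    rw [h1]
    ext k
    rw [congrFun hγ k, congrFun hγ (k - 1), zpow_sub_one₀ hq0]
    simp only [seqShift]
    field_simp
    ring
  have hbneg : ∀ k < 0, b k = 0 := fun k hk => hp_neg k hk u v
  have hb0 : b 0 = 1 := hp_zero u v
  have hκ : ∏ i ∈ range (n + 1), q ^ (n + 1 - i)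
      = q ^ (n + 1) * ∏ i ∈ range n, q ^ (n - i) := by
    rw [Finset.prod_range_succ', mul_comm]
    simp
  have hq2 : 1 - q ≠ 0 := sub_ne_zero.mpr hq1.symm
  have hcancel : ∀ {X Y W : K}, (γ - β) * X = γ * Y - β * W → Y + q * v * W = (1 + q * v) * X := by
    intro X Y W hXYW
    have hqβ : q * β = q * v * (1 - q) := by simp only [β]; ring
    have hqγ : q * γ = -(1 - q) := by simp only [γ]; field_simp
    refine mul_left_cancel₀ hq2 ?_
    linear_combination q * hXYW - (X - Y) * hqγ - (W - X) * hqβ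
  refine ⟨?_, ?_, ?_, ?_⟩
  · rw [hβ, hγ, hγβ, hb, staircaseDet_zpow_mul hq0, staircaseDet_zpow_mul hq0,
      staircaseDet_zpow_mul hq0, hκ]
    linear_combination (q ^ (n + 1) * ∏ i ∈ range n, q ^ (n - i)) *
      hcancel (staircaseDet_plucker_dual n b hbneg hb0 γ β)
  · rw [hβ, hγ, hγβ, hb, staircaseDet_zpow_mul hq0, staircaseDet_zpow_mul hq0,
      staircaseDet_zpow_mul hq0, hκ]
    linear_combination (q ^ (n + 1) * ∏ i ∈ range n, q ^ (n - i)) *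
      hcancel (staircaseDet_plucker n b γ β)
  · rw [hβ, hα, hαβ, hb]
    have key := staircaseDet_symm_plucker n b hbneg hb0 α β
    refine mul_left_cancel₀ hq2 ?_
    linear_combination q * key
  · rw [hβ, hα, hαβ, hb]
    have key := staircaseDet_symm_plucker n b hbneg hb0 β α
    have hc : seqShift β (seqShift α b) = seqShift α (seqShift β b) := by
      ext k
      simp only [seqShift]
      ring
    rw [hc] at key
    refine mul_left_cancel₀ hq2 ?_
    linear_combination q * key

theorem bilinearRel_phi (q : K) (hq0 : q ≠ 0) (p : ℤ → K → K → K) (y z : K)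
    (h : ∀ n : ℕ, BilinearRel q (q ^ (n + 1)) (phiAux p n) (phiAux p (n + 1)) y z) (N : ℤ) :
    BilinearRel q (q ^ N) (phi p (N - 1)) (phi p N) y z := by
  have hnat : ∀ n : ℕ, phi p (n : ℤ) = phiAux p n := by
    intro n
    ext y z
    simp [phi]
  have hneg : ∀ n : ℕ, phi p (-(n : ℤ) - 1)
      = fun y z => (-1 : K) ^ ((-(n : ℤ) - 1) * (-(n : ℤ) - 1 + 1) / 2) * phiAux p n y z := by
    intro n
    ext y z
    rw [phi, if_neg (by omega)]
    congr 2
    omega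
  have hzero : phiAux p 0 = fun _ _ => 1 := by
    ext y z
    simp [phiAux]
  rcases lt_trichotomy N 0 with hN | rfl | hN
  · obtain ⟨n, rfl⟩ : ∃ n : ℕ, N = -(n : ℤ) - 1 := ⟨(-N - 1).toNat, by omega⟩
    have h' := (h n).swap (pow_ne_zero _ hq0)
    rw [hneg n, show -(n : ℤ) - 1 - 1 = -((n + 1 : ℕ) : ℤ) - 1 by push_cast; ring, hneg (n + 1),
      show -(n : ℤ) - 1 = -((n + 1 : ℕ) : ℤ) by push_cast; ring, _root_.zpow_neg, zpow_natCast]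
    exact h'.smul _ _
  · have h1 : phi p (0 - 1) = fun _ _ => 1 := by
      have := hneg 0
      simpa [hzero] using this
    have h0 : phi p 0 = fun _ _ => 1 := by
      have := hnat 0
      simpa [hzero] using this
    rw [h1, h0]
    refine ⟨?_, ?_, ?_, ?_⟩ <;> simp <;> ring
  · obtain ⟨n, rfl⟩ : ∃ n : ℕ, N = ((n + 1 : ℕ) : ℤ) := ⟨(N - 1).toNat, by omega⟩
    rw [show ((n + 1 : ℕ) : ℤ) - 1 = (n : ℤ) by push_cast; ring, hnat, hnat, zpow_natCast]
    exact h n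

end Bilinear

theorem qP3_system
    {K : Type*} [Field K] (q : K) (hq0 : q ≠ 0)
    (hq1 : ∀ k : ℕ, 1 ≤ k → q ^ k ≠ 1)
    (p : ℤ → K → K → K)
    (hp_neg : ∀ k : ℤ, k < 0 → ∀ y z : K, p k y z = 0)
    (hp_zero : ∀ y z : K, p 0 y z = 1)
    (hC1 : ∀ k : ℕ, 1 ≤ k → ∀ y z : K,
      (∑ i ∈ Finset.range k, q ^ i) * p (k : ℤ) y z
        = (y + z + q ^ (k - 1)) * p ((k : ℤ) - 1) y z
          - (1 - q) * y * z * p ((k : ℤ) - 2) y z)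
    (hC2 : ∀ (k : ℤ) (y z : K), p k y (q * z) - p k y z = (q - 1) * z * p (k - 1) y z)
    (hC3 : ∀ (k : ℤ) (y z : K), p k (q * y) z - p k y z = (q - 1) * y * p (k - 1) y z)
    (N : ℤ) (y z : K) (hz : z ≠ 0)
    (F0 F1 : K → K)
    (hF0 : ∀ w : K, F0 w =
      q ^ N * phi p (N - 1) y w * phi p N (y / q) w
        / (phi p (N - 1) (y / q) w * phi p N y w))
    (hF1 : ∀ w : K, F1 w =
      phi p (N - 1) (y / q) (w / q) * phi p N y w
        / (phi p (N - 1) y w * phi p N (y / q) (w / q)))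
    (h1a : phi p (N - 1) y z ≠ 0) (h1b : phi p N y z ≠ 0)
    (h2a : phi p (N - 1) (y / q) z ≠ 0) (h2b : phi p N (y / q) z ≠ 0)
    (h3a : phi p (N - 1) y (z / q) ≠ 0) (h3b : phi p N y (z / q) ≠ 0)
    (h4a : phi p (N - 1) (y / q) (z / q) ≠ 0) (h4b : phi p N (y / q) (z / q) ≠ 0)
    (h5a : phi p (N - 1) y (q * z) ≠ 0) (h5b : phi p N y (q * z) ≠ 0)
    (hd1 : z + F0 z ≠ 0) (hd2 : 1 + y / z * F1 z ≠ 0) :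
    F1 (q * z) = q ^ (2 * N) / (F0 z * F1 z) * ((1 + z * F0 z) / (z + F0 z)) ∧
    F0 (z / q) = q ^ (2 * N) / (F0 z * F1 z) * ((y / z + F1 z) / (1 + y / z * F1 z)) := by
  obtain ⟨e1, e2, e3, e4⟩ := bilinearRel_phi q hq0 p y z
    (bilinearRel_phiAux q hq0 (by simpa using hq1 1 le_rfl) p hp_neg hp_zero hC1 hC2 hC3 · y z) N
  have hc : q ^ N ≠ 0 := zpow_ne_zero _ hq0
  have hc2 : q ^ (2 * N) = q ^ N * q ^ N := by rw [two_mul, zpow_add₀ hq0]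
  constructor
  · have r : (1 + z * F0 z) / (z + F0 z)
        = (phi p (N - 1) (y / q) (z / q) * phi p N y (q * z))
          / (q ^ N * (phi p (N - 1) y (q * z) * phi p N (y / q) (z / q))) := by
      rw [div_eq_div_iff hd1 (by simp [*]), hF0]
      field_simp
      rw [mul_comm q z] at e1 e2
      linear_combination (q ^ N * phi p (N - 1) y (z * q) * phi p N (y / q) (z / q)) * e1
        - (phi p (N - 1) (y / q) (z / q) * phi p N y (z * q)) * e2
    rw [r, hF0, hF1, hF1, mul_div_cancel_left₀ _ hq0, hc2]
    field_simp
  · have r : (y / z + F1 z) / (1 + y / z * F1 z)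
        = (phi p (N - 1) y (z / q) * phi p N (y / q) z)
          / (phi p (N - 1) (y / q) z * phi p N y (z / q)) := by
      rw [div_eq_div_iff hd2 (by simp [*]), hF1]
      field_simp
      linear_combination (phi p (N - 1) (y / q) z * phi p N y (z / q)) * e3
        - (phi p (N - 1) y (z / q) * phi p N (y / q) z) * e4
    rw [r, hF0, hF0, hF1, hc2]
    field_simp
end

section
/- Fix an integer N and elements y, z ∈ K with z ≠ 0, and assume φ_{N−1}(y/q,z) ≠ 0 and φ_N(y,z) ≠ 0. Set F0 = q^N · φ_{N−1}(y,z) · φ_N(y/q,z) / (φ_{N−1}(y/q,z) · φ_N(y,z)). Then the multiplicative formulas hold: 1 + z·F0 = (1 + z) · φ_{N−1}(y/q,z/q) · φ_N(y,qz) / (φ_{N−1}(y/q,z) · φ_N(y,z)), and 1 + (1/z)·F0 = q^N · (1 + 1/z) · φ_{N−1}(y,qz) · φ_N(y/q,z/q) / (φ_{N−1}(y/q,z) · φ_N(y,z)). -/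
open Matrix Finset

/-- The determinant `det (f (n - 2i + j))_{0 ≤ i,j ≤ n-1}`, a staircase Schur function when `f`
is the sequence of complete symmetric functions. -/
def stairDet {K : Type*} [Field K] (f : ℤ → K) (n : ℕ) : K :=
  Matrix.det (Matrix.of fun i j : Fin n => f ((n : ℤ) - 2 * ((i : ℕ) : ℤ) + ((j : ℕ) : ℤ)))

/-- The coefficient sequence of `(1 - a t) * ∑ k, f k * t ^ k`. -/
def mulLin {K : Type*} [Field K] (a : K) (f : ℤ → K) (k : ℤ) : K := f k - a * f (k - 1)

theorem mulLin_of_neg {K : Type*} [Field K] {f : ℤ → K} (hf : ∀ k < 0, f k = 0) (a : K) :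
    ∀ k < 0, mulLin a f k = 0 := by
  intro k hk
  simp [mulLin, hf k hk, hf (k - 1) (by omega)]

theorem mulLin_comm {K : Type*} [Field K] (a b : K) (f : ℤ → K) :
    mulLin a (mulLin b f) = mulLin b (mulLin a f) := by
  funext k
  simp only [mulLin]
  ring

/-- Column operations replace all columns but the first by those of `mulLin a f`. -/
theorem det_shift_eq_det_cons_mulLin {K : Type*} [Field K] (a : K) (f : ℤ → K) (n : ℕ)
    (r : Fin (n + 1) → ℤ) :
    Matrix.det (Matrix.of fun i j : Fin (n + 1) => f (r i + ((j : ℕ) : ℤ))) =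
      Matrix.det (Matrix.of fun i : Fin (n + 1) => (Fin.cons (f (r i))
        (fun j : Fin n => mulLin a f (r i + ((j : ℕ) : ℤ) + 1)) : Fin (n + 1) → K)) := by
  refine Matrix.det_eq_of_forall_col_eq_smul_add_pred (fun _ => a) ?_ ?_
  · intro i
    simp
  · intro i j
    simp only [Matrix.of_apply, Fin.cons_succ, Fin.val_succ, Fin.val_castSucc, mulLin]
    rw [show r i + ((j : ℕ) : ℤ) + 1 - 1 = r i + ((j : ℕ) : ℤ) by ring]
    push_cast
    rw [← add_assoc]
    ring

/-- `n + 1` vectors in a space of dimension `n` are linearly dependent, with the maximal minors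
as coefficients; here the dependency is tested against a linear functional with weights `w`. -/
theorem sum_minors_mul_functional_eq_zero {K : Type*} [Field K] {n : ℕ}
    (v : Fin n → Fin (n + 1) → K) (w : Fin n → K) :
    ∑ j : Fin (n + 1), (-1) ^ (j : ℕ) * (∑ i, w i * v i j) *
      Matrix.det (Matrix.of fun i k : Fin n => v i (j.succAbove k)) = 0 := by
  let Y : Matrix (Fin (n + 1)) (Fin (n + 1)) K :=
    Matrix.of (Fin.cons (fun j => ∑ i, w i * v i j) v)
  have hdet : Y.det = 0 := by
    rw [← Matrix.exists_vecMul_eq_zero_iff]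
    refine ⟨Fin.cons (-1) w, ?_, ?_⟩
    · intro h
      simpa using congrFun h 0
    · funext j
      simp [Y, Matrix.vecMul, dotProduct, Fin.sum_univ_succ]
  rw [Matrix.det_succ_row_zero] at hdet
  rw [← hdet]
  rfl

/-- A three-term Plücker relation. -/
theorem det_cons_plucker {K : Type*} [Field K] {m : ℕ} (A B : Fin (m + 3) → K)
    (C : Fin (m + 3) → ℕ → K) (hA : A (Fin.last _) = 0) (hB : B (Fin.last _) = 0)
    (hC : ∀ j ≤ m, C (Fin.last _) j = 0) :
    Matrix.det (Matrix.of fun i : Fin (m + 3) =>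
        (Fin.cons (A i) (fun j : Fin (m + 2) => C i (j + 1)) : Fin (m + 3) → K)) *
      Matrix.det (Matrix.of fun i : Fin (m + 2) =>
        (Fin.cons (B i.castSucc) (fun j : Fin (m + 1) => C i.castSucc j) : Fin (m + 2) → K)) -
    Matrix.det (Matrix.of fun i : Fin (m + 3) =>
        (Fin.cons (B i) (fun j : Fin (m + 2) => C i (j + 1)) : Fin (m + 3) → K)) *
      Matrix.det (Matrix.of fun i : Fin (m + 2) =>
        (Fin.cons (A i.castSucc) (fun j : Fin (m + 1) => C i.castSucc j) : Fin (m + 2) → K)) +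
    Matrix.det (Matrix.of fun i : Fin (m + 3) =>
        (Fin.cons (C i 0) (fun j : Fin (m + 2) => C i (j + 1)) : Fin (m + 3) → K)) *
      Matrix.det (Matrix.of fun i : Fin (m + 2) =>
        (Fin.cons (A i.castSucc) (Fin.cons (B i.castSucc)
          (fun j : Fin m => C i.castSucc (j + 1))) : Fin (m + 2) → K)) = 0 := by
  let μ : Fin (m + 3) → K := fun i => (-1) ^ (i : ℕ) *
    Matrix.det (Matrix.of fun (k l : Fin (m + 2)) => C (i.succAbove k) (l + 1))
  have key : ∀ x : Fin (m + 3) → K, x (Fin.last _) = 0 →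
      ∑ i : Fin (m + 2), μ i.castSucc * x i.castSucc = Matrix.det (Matrix.of fun i =>
        (Fin.cons (x i) (fun j : Fin (m + 2) => C i (j + 1)) : Fin (m + 3) → K)) := by
    intro x hx
    rw [Matrix.det_succ_column_zero, Fin.sum_univ_castSucc (n := m + 2)]
    simp only [Matrix.of_apply, Fin.cons_zero, hx, mul_zero, zero_mul, add_zero]
    refine Finset.sum_congr rfl fun i _ => ?_
    simp only [μ]
    rw [mul_right_comm]
    rfl
  have h := sum_minors_mul_functional_eq_zero
    (fun i : Fin (m + 2) => (Fin.cons (A i.castSucc) (Fin.cons (B i.castSucc)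
      (fun j : Fin (m + 1) => C i.castSucc j)) : Fin (m + 3) → K)) (fun i => μ i.castSucc)
  have hz : ∀ j : Fin m, ∑ i : Fin (m + 2), μ i.castSucc * C i.castSucc (j + 1) = 0 := by
    intro j
    rw [key (fun i => C i (j + 1)) (hC _ (by omega))]
    refine Matrix.det_zero_of_column_eq (i := 0) (j := j.castSucc.castSucc.succ)
      (Fin.succ_ne_zero _).symm ?_
    intro k
    simp
  have e0 : Matrix.of (fun i k : Fin (m + 2) => (Fin.cons (A i.castSucc) (Fin.cons (B i.castSucc)
      (fun j : Fin (m + 1) => C i.castSucc j)) : Fin (m + 3) → K) ((0 : Fin (m + 3)).succAbove k)) =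
      Matrix.of fun i : Fin (m + 2) =>
        (Fin.cons (B i.castSucc) (fun j : Fin (m + 1) => C i.castSucc j) : Fin (m + 2) → K) := by
    ext i k
    simp
  have e1 : Matrix.of (fun i k : Fin (m + 2) => (Fin.cons (A i.castSucc) (Fin.cons (B i.castSucc)
      (fun j : Fin (m + 1) => C i.castSucc j)) : Fin (m + 3) → K)
        ((0 : Fin (m + 2)).succ.succAbove k)) =
      Matrix.of fun i : Fin (m + 2) =>
        (Fin.cons (A i.castSucc) (fun j : Fin (m + 1) => C i.castSucc j) : Fin (m + 2) → K) := by
    ext i k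
    refine Fin.cases ?_ (fun k => ?_) k <;> simp
  have e2 : Matrix.of (fun i k : Fin (m + 2) => (Fin.cons (A i.castSucc) (Fin.cons (B i.castSucc)
      (fun j : Fin (m + 1) => C i.castSucc j)) : Fin (m + 3) → K)
        ((0 : Fin (m + 1)).succ.succ.succAbove k)) =
      Matrix.of fun i : Fin (m + 2) => (Fin.cons (A i.castSucc) (Fin.cons (B i.castSucc)
          (fun j : Fin m => C i.castSucc (j + 1))) : Fin (m + 2) → K) := by
    ext i k
    refine Fin.cases ?_ (fun k => ?_) k
    · simp only [Matrix.of_apply, Fin.succ_succAbove_zero, Fin.cons_zero]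
    · refine Fin.cases ?_ (fun k => ?_) k <;>
        simp only [Matrix.of_apply, Fin.succ_succAbove_succ, Fin.succ_succAbove_zero,
          Fin.zero_succAbove, Fin.cons_zero, Fin.cons_succ, Fin.val_succ]
  obtain ⟨L, hL⟩ : ∃ L : Fin (m + 3) → K, L = fun j => ∑ i : Fin (m + 2), μ i.castSucc *
      (Fin.cons (A i.castSucc) (Fin.cons (B i.castSucc) (fun j : Fin (m + 1) => C i.castSucc j)) :
        Fin (m + 3) → K) j := ⟨_, rfl⟩
  have hL0 := congrFun hL 0
  have hL1 := congrFun hL (Fin.succ 0)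
  have hL2 := congrFun hL (Fin.succ (Fin.succ 0))
  have hL3 (j : Fin m) : L j.succ.succ.succ = 0 := by
    rw [← hz j, hL]
    simp
  simp only [Fin.cons_zero, Fin.cons_succ, Fin.val_zero] at hL0 hL1 hL2
  rw [key A hA] at hL0
  rw [key B hB] at hL1
  rw [key (fun i => C i 0) (hC 0 (Nat.zero_le _))] at hL2
  rw [← hL0, ← hL1, ← hL2, ← e0, ← e1, ← e2]
  have h' : ∑ j : Fin (m + 3), (-1) ^ (j : ℕ) * L j * Matrix.det (Matrix.of fun i k : Fin (m + 2) =>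
      (Fin.cons (A i.castSucc) (Fin.cons (B i.castSucc) (fun j : Fin (m + 1) => C i.castSucc j)) :
        Fin (m + 3) → K) (j.succAbove k)) = 0 := by
    rw [hL]
    exact h
  rw [Fin.sum_univ_succ, Fin.sum_univ_succ, Fin.sum_univ_succ] at h'
  simp only [hL3, Fin.val_succ, Fin.val_zero, mul_zero, zero_mul, Finset.sum_const_zero,
    add_zero] at h'
  linear_combination h'

theorem stairDet_succ {K : Type*} [Field K] (a : K) (f : ℤ → K) (n : ℕ) :
    stairDet f (n + 1) = Matrix.det (Matrix.of fun i : Fin (n + 1) =>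
      (Fin.cons (f ((n : ℤ) + 1 - 2 * ((i : ℕ) : ℤ)))
        (fun j : Fin n => mulLin a f ((n : ℤ) + 1 - 2 * ((i : ℕ) : ℤ) + ((j : ℕ) : ℤ) + 1)) :
          Fin (n + 1) → K)) := by
  rw [← det_shift_eq_det_cons_mulLin a f n (fun i => (n : ℤ) + 1 - 2 * ((i : ℕ) : ℤ))]
  simp [stairDet]

theorem mul_stairDet {K : Type*} [Field K] (a : K) (f : ℤ → K) (m : ℕ) :
    a * stairDet f (m + 2) = Matrix.det (Matrix.of fun i : Fin (m + 2) =>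
      (Fin.cons (f ((m : ℤ) + 3 - 2 * ((i : ℕ) : ℤ)))
        (fun j : Fin (m + 1) => mulLin a f ((m : ℤ) + 3 - 2 * ((i : ℕ) : ℤ) + ((j : ℕ) : ℤ))) :
          Fin (m + 2) → K)) := by
  set M := Matrix.of fun i : Fin (m + 2) =>
      (Fin.cons (f ((m : ℤ) + 2 - 2 * ((i : ℕ) : ℤ)))
        (fun j : Fin (m + 1) => mulLin a f ((m : ℤ) + 3 - 2 * ((i : ℕ) : ℤ) + ((j : ℕ) : ℤ))) :
          Fin (m + 2) → K) with hM
  have h : stairDet f (m + 2) = M.det := by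
    rw [stairDet_succ a, hM]
    congr 1
    ext i j
    refine Fin.cases ?_ (fun j => ?_) j
    · simp only [Matrix.of_apply, Fin.cons_zero]
      congr 1
    · simp only [Matrix.of_apply, Fin.cons_succ]
      congr 1
      push_cast
      ring
  rw [h]
  have h2 : M.det = (M.updateCol 0 (fun i => M i 0)).det := by rw [Matrix.updateCol_eq_self]
  rw [h2, ← Matrix.det_updateCol_smul,
    ← Matrix.det_updateCol_add_self (M.updateCol 0 (a • fun i => M i 0)) (i := 0) (j := 1)
      (by simp)]
  congr 1
  ext i j
  refine Fin.cases ?_ (fun j => ?_) j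
  · have h1 : (1 : Fin (m + 2)) = (0 : Fin (m + 1)).succ := rfl
    simp only [Matrix.updateCol_self, Matrix.updateCol_ne (Fin.succ_ne_zero _), Pi.smul_apply,
      hM, Matrix.of_apply, Fin.cons_zero, h1, Fin.cons_succ, mulLin, smul_eq_mul]
    rw [show (m : ℤ) + 3 - 2 * ((i : ℕ) : ℤ) + (((0 : Fin (m + 1)) : ℕ) : ℤ) - 1 =
      (m : ℤ) + 2 - 2 * ((i : ℕ) : ℤ) by simp; ring]
    simp
  · simp [hM]

theorem sub_mul_stairDet {K : Type*} [Field K] (a b : K) (f : ℤ → K) (m : ℕ) :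
    (a - b) * stairDet f (m + 2) = Matrix.det (Matrix.of fun i : Fin (m + 2) =>
      (Fin.cons (mulLin b f ((m : ℤ) + 3 - 2 * ((i : ℕ) : ℤ)))
        (Fin.cons (mulLin a f ((m : ℤ) + 3 - 2 * ((i : ℕ) : ℤ)))
        (fun j : Fin m => mulLin a (mulLin b f)
          ((m : ℤ) + 3 - 2 * ((i : ℕ) : ℤ) + ((j : ℕ) : ℤ) + 1))) : Fin (m + 2) → K)) := by
  set M := Matrix.of fun i : Fin (m + 2) =>
      (Fin.cons (f ((m : ℤ) + 2 - 2 * ((i : ℕ) : ℤ)))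
        (Fin.cons (mulLin a f ((m : ℤ) + 3 - 2 * ((i : ℕ) : ℤ)))
        (fun j : Fin m => mulLin a (mulLin b f)
          ((m : ℤ) + 3 - 2 * ((i : ℕ) : ℤ) + ((j : ℕ) : ℤ) + 1))) : Fin (m + 2) → K) with hM
  have h : stairDet f (m + 2) = M.det := by
    rw [stairDet_succ a, hM]
    refine Matrix.det_eq_of_forall_col_eq_smul_add_pred (Fin.cons 0 fun _ => b) ?_ ?_
    · intro i
      simp only [Matrix.of_apply, Fin.cons_zero]
      congr 1
    · intro i j
      refine Fin.cases ?_ (fun j => ?_) j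
      · simp only [Matrix.of_apply, Fin.cons_succ, Fin.cons_zero, zero_mul, add_zero]
        congr 1
        simp
        ring
      · rw [← Fin.succ_castSucc]
        simp only [Matrix.of_apply, Fin.cons_succ, Fin.val_succ, Fin.val_castSucc]
        rw [mulLin_comm]
        simp only [mulLin.eq_1 b (mulLin a f)]
        push_cast
        rw [show (m : ℤ) + 1 + 1 - 2 * ((i : ℕ) : ℤ) + (((j : ℕ) : ℤ) + 1) + 1 =
            (m : ℤ) + 3 - 2 * ((i : ℕ) : ℤ) + ((j : ℕ) : ℤ) + 1 by ring,
          show (m : ℤ) + 1 + 1 - 2 * ((i : ℕ) : ℤ) + ((j : ℕ) : ℤ) + 1 =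
            (m : ℤ) + 3 - 2 * ((i : ℕ) : ℤ) + ((j : ℕ) : ℤ) + 1 - 1 by ring]
        ring
  rw [h]
  have h2 : M.det = (M.updateCol 0 (fun i => M i 0)).det := by rw [Matrix.updateCol_eq_self]
  rw [h2, ← Matrix.det_updateCol_smul,
    ← Matrix.det_updateCol_add_self (M.updateCol 0 ((a - b) • fun i => M i 0)) (i := 0) (j := 1)
      (by simp)]
  congr 1
  ext i j
  refine Fin.cases ?_ (fun j => ?_) j
  · have h1 : (1 : Fin (m + 2)) = (0 : Fin (m + 1)).succ := rfl
    simp only [Matrix.updateCol_self, Matrix.updateCol_ne (Fin.succ_ne_zero _), Pi.smul_apply,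
      hM, Matrix.of_apply, Fin.cons_zero, h1, Fin.cons_succ, mulLin, smul_eq_mul]
    rw [show (m : ℤ) + 3 - 2 * ((i : ℕ) : ℤ) - 1 = (m : ℤ) + 2 - 2 * ((i : ℕ) : ℤ) by ring]
    ring
  · simp [hM]

/-- A bilinear identity for staircase determinants valid for an arbitrary sequence. -/
theorem stairDet_bilinear {K : Type*} [Field K] {f : ℤ → K} (hf : ∀ k < 0, f k = 0) (a b : K)
    (n : ℕ) :
    a * stairDet (mulLin b f) n * stairDet (mulLin a f) (n + 1) -
      b * stairDet (mulLin a f) n * stairDet (mulLin b f) (n + 1) =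
    (a - b) * stairDet f n * stairDet (mulLin a (mulLin b f)) (n + 1) := by
  match n with
  | 0 =>
    simp [stairDet, mulLin, hf (-1) (by norm_num)]
    ring
  | 1 =>
    simp [stairDet, mulLin, Matrix.det_fin_two, hf (-1) (by norm_num), hf (-2) (by norm_num)]
    ring
  | m + 2 =>
    have hneg := mulLin_of_neg (mulLin_of_neg hf b) a
    have h := det_cons_plucker (m := m)
      (fun i => mulLin b f ((m : ℤ) + 3 - 2 * ((i : ℕ) : ℤ)))
      (fun i => mulLin a f ((m : ℤ) + 3 - 2 * ((i : ℕ) : ℤ)))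
      (fun i j => mulLin a (mulLin b f) ((m : ℤ) + 3 - 2 * ((i : ℕ) : ℤ) + (j : ℤ)))
      (mulLin_of_neg hf b _ (by simp; omega)) (mulLin_of_neg hf a _ (by simp; omega))
      (fun j hj => hneg _ (by simp; omega))
    have ha := mul_stairDet a (mulLin b f) m
    have hb := mul_stairDet b (mulLin a f) m
    have hab := sub_mul_stairDet a b f m
    have ha' := stairDet_succ a (mulLin b f) (m + 2)
    have hb' := stairDet_succ b (mulLin a f) (m + 2)
    have hab' : stairDet (mulLin a (mulLin b f)) (m + 3) = Matrix.det (Matrix.of fun i : Fin (m + 3) =>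
        (Fin.cons (mulLin a (mulLin b f) ((m : ℤ) + 3 - 2 * ((i : ℕ) : ℤ) + ((0 : ℕ) : ℤ)))
          (fun j : Fin (m + 2) => mulLin a (mulLin b f)
            ((m : ℤ) + 3 - 2 * ((i : ℕ) : ℤ) + (((j : ℕ) + 1 : ℕ) : ℤ))) : Fin (m + 3) → K)) := by
      rw [stairDet]
      congr 1
      ext i j
      refine Fin.cases ?_ (fun j => ?_) j <;> simp
    rw [mulLin_comm b a] at hb hb'
    simp only [Nat.cast_add, Nat.cast_one, Nat.cast_ofNat, ← add_assoc] at h ha' hb' hab'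
    rw [show (m : ℤ) + 2 + 1 = m + 3 by ring] at ha' hb'
    simp only [Fin.val_castSucc] at h
    rw [ha, hb, hab, ha', hb', hab']
    linear_combination -h

/-- Multiplying the generating function by `1 - a ^ 2 * t ^ 2` leaves `stairDet` unchanged. -/
theorem stairDet_mulLin_mulLin_neg {K : Type*} [Field K] {f : ℤ → K} (hf : ∀ k < 0, f k = 0)
    (a : K) (n : ℕ) : stairDet (mulLin a (mulLin (-a) f)) n = stairDet f n := by
  cases n with
  | zero => simp [stairDet]
  | succ n =>
    rw [stairDet, stairDet, ← Matrix.det_submatrix_equiv_self Fin.revPerm,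
      ← Matrix.det_submatrix_equiv_self Fin.revPerm (Matrix.of _)]
    symm
    refine Matrix.det_eq_of_forall_row_eq_smul_add_pred (fun _ => a ^ 2) ?_ ?_
    · intro j
      simp only [Matrix.submatrix_apply, Matrix.of_apply, mulLin, Fin.revPerm_apply, Fin.val_rev,
        Fin.val_zero]
      have hj := j.2
      set x := f _
      rw [hf (_ - 1 - 1) (by push_cast [Nat.cast_sub (show (j : ℕ) + 1 ≤ n + 1 by omega)]; omega)]
      ring
    · intro i j
      simp only [Matrix.submatrix_apply, Matrix.of_apply, mulLin, Fin.revPerm_apply, Fin.val_rev,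
        Fin.val_succ, Fin.val_castSucc]
      have hi := i.2
      rw [show n + 1 - ((i : ℕ) + 1) = n + 1 - ((i : ℕ) + 1 + 1) + 1 by omega]
      push_cast
      ring_nf

theorem stairDet_bilinear_dual {K : Type*} [Field K] {f : ℤ → K} (hf : ∀ k < 0, f k = 0) (a b : K)
    (n : ℕ) :
    b * stairDet (mulLin b f) n * stairDet (mulLin a f) (n + 1) -
      a * stairDet (mulLin a f) n * stairDet (mulLin b f) (n + 1) =
    (b - a) * stairDet (mulLin a (mulLin b f)) n * stairDet f (n + 1) := by
  have h := stairDet_bilinear (mulLin_of_neg (mulLin_of_neg hf b) a) (-a) (-b) n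
  have h1 (k : ℕ) : stairDet (mulLin (-a) (mulLin a (mulLin b f))) k = stairDet (mulLin b f) k := by
    rw [mulLin_comm]
    exact stairDet_mulLin_mulLin_neg (mulLin_of_neg hf b) a k
  have h2 (k : ℕ) : stairDet (mulLin (-b) (mulLin a (mulLin b f))) k = stairDet (mulLin a f) k := by
    rw [mulLin_comm a, mulLin_comm]
    exact stairDet_mulLin_mulLin_neg (mulLin_of_neg hf a) b k
  have h3 (k : ℕ) : stairDet (mulLin (-a) (mulLin (-b) (mulLin a (mulLin b f)))) k =
      stairDet f k := by
    have h4 : mulLin (-a) (mulLin (-b) (mulLin a (mulLin b f))) =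
        mulLin a (mulLin (-a) (mulLin b (mulLin (-b) f))) := by
      funext k
      simp only [mulLin]
      ring
    rw [h4, stairDet_mulLin_mulLin_neg (mulLin_of_neg (mulLin_of_neg hf _) _),
      stairDet_mulLin_mulLin_neg hf]
  rw [h1, h1, h2, h2, h3] at h
  linear_combination h

theorem stairDet_scale {K : Type*} [Field K] {q : K} (hq : q ≠ 0) (f : ℤ → K) (n : ℕ) :
    stairDet (fun k => q ^ k * f k) n = (∏ i : Fin n, q ^ ((n : ℤ) - ((i : ℕ) : ℤ))) *
      stairDet f n := by
  have h : (∏ i : Fin n, q ^ ((n : ℤ) - ((i : ℕ) : ℤ))) =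
      (∏ i : Fin n, q ^ ((n : ℤ) - 2 * ((i : ℕ) : ℤ))) * ∏ j : Fin n, q ^ ((j : ℕ) : ℤ) := by
    rw [← Finset.prod_mul_distrib]
    refine Finset.prod_congr rfl fun i _ => ?_
    rw [← zpow_add₀ hq]
    congr 1
    ring
  rw [h, mul_assoc, stairDet, stairDet, ← Matrix.det_mul_row, ← Matrix.det_mul_column]
  congr 1
  ext i j
  simp only [Matrix.of_apply]
  rw [zpow_add₀ hq]
  ring

theorem prod_zpow_sub_succ {K : Type*} [Field K] (q : K) (n : ℕ) :
    ∏ i : Fin (n + 1), q ^ (((n + 1 : ℕ) : ℤ) - ((i : ℕ) : ℤ)) =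
      q ^ (n + 1) * ∏ i : Fin n, q ^ ((n : ℤ) - ((i : ℕ) : ℤ)) := by
  rw [Fin.prod_univ_succ]
  congr 1
  · rw [← zpow_natCast]
    simp
  · simp

/-- The `q`-difference equation of the generating function, read off from the contiguity
relations. -/
theorem contiguity_scale {K : Type*} [Field K] {q : K} (hq0 : q ≠ 0) {p : ℤ → K → K → K}
    (hp_neg : ∀ k : ℤ, k < 0 → ∀ y z : K, p k y z = 0)
    (hp_zero : ∀ y z : K, p 0 y z = 1)
    (hC1 : ∀ k : ℕ, 1 ≤ k → ∀ y z : K,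
      (∑ i ∈ Finset.range k, q ^ i) * p (k : ℤ) y z
        = (y + z + q ^ (k - 1)) * p ((k : ℤ) - 1) y z
          - (1 - q) * y * z * p ((k : ℤ) - 2) y z)
    (hC2 : ∀ (k : ℤ) (y z : K), p k y (q * z) - p k y z = (q - 1) * z * p (k - 1) y z)
    (hC3 : ∀ (k : ℤ) (y z : K), p k (q * y) z - p k y z = (q - 1) * y * p (k - 1) y z)
    (k : ℤ) (y z : K) :
    p k (q * y) (q * z) = q ^ k * mulLin (-(1 - q) / q) (fun l => p l y z) k := by
  rw [mulLin]
  rcases lt_trichotomy k 0 with hk | rfl | hk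
  · simp [hp_neg k hk, hp_neg (k - 1) (by omega)]
  · simp [hp_zero, hp_neg (-1) (by norm_num)]
  · lift k to ℕ using hk.le
    obtain ⟨n, rfl⟩ : ∃ n, k = n + 1 := ⟨k - 1, by omega⟩
    have e1 := hC1 (n + 1) (by omega) y z
    have e2 := hC2 ((n + 1 : ℕ) : ℤ) (q * y) z
    have e3 := hC3 ((n + 1 : ℕ) : ℤ) y z
    have e4 := hC3 (((n + 1 : ℕ) : ℤ) - 1) y z
    have hg := geom_sum_mul q (n + 1)
    rw [show ((n + 1 : ℕ) : ℤ) - 1 - 1 = ((n + 1 : ℕ) : ℤ) - 2 by ring] at e4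
    rw [Nat.add_sub_cancel] at e1
    have hdiv : q ^ (n + 1) * (-(1 - q) / q) = -(1 - q) * q ^ n := by
      field_simp
      ring
    rw [zpow_natCast, mul_sub, ← mul_assoc (q ^ (n + 1)), hdiv]
    linear_combination e2 + e3 + (q - 1) * z * e4 - (q - 1) * e1 + p ((n + 1 : ℕ) : ℤ) y z * hg

theorem phiAux_bilinear {K : Type*} [Field K] {q : K} (hq0 : q ≠ 0) (hq1 : q ≠ 1)
    {p : ℤ → K → K → K}
    (hp_neg : ∀ k : ℤ, k < 0 → ∀ y z : K, p k y z = 0)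
    (hp_zero : ∀ y z : K, p 0 y z = 1)
    (hC1 : ∀ k : ℕ, 1 ≤ k → ∀ y z : K,
      (∑ i ∈ Finset.range k, q ^ i) * p (k : ℤ) y z
        = (y + z + q ^ (k - 1)) * p ((k : ℤ) - 1) y z
          - (1 - q) * y * z * p ((k : ℤ) - 2) y z)
    (hC2 : ∀ (k : ℤ) (y z : K), p k y (q * z) - p k y z = (q - 1) * z * p (k - 1) y z)
    (hC3 : ∀ (k : ℤ) (y z : K), p k (q * y) z - p k y z = (q - 1) * y * p (k - 1) y z)
    (n : ℕ) (y z : K) :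
    phiAux p n (y / q) z * phiAux p (n + 1) y z +
        z * q ^ (n + 1) * phiAux p n y z * phiAux p (n + 1) (y / q) z =
      (1 + z) * phiAux p n (y / q) (z / q) * phiAux p (n + 1) y (q * z) ∧
    z * phiAux p n (y / q) z * phiAux p (n + 1) y z +
        q ^ (n + 1) * phiAux p n y z * phiAux p (n + 1) (y / q) z =
      q ^ (n + 1) * (1 + z) * phiAux p n y (q * z) * phiAux p (n + 1) (y / q) (z / q) := by
  set f : ℤ → K := fun k => p k (y / q) (z / q) with hf
  have hneg : ∀ k < 0, f k = 0 := fun k hk => hp_neg k hk _ _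
  set a : K := -(1 - q) / q with ha
  set b : K := (1 - q) * (z / q) with hb
  have hy : q * (y / q) = y := mul_div_cancel₀ y hq0
  have hz : q * (z / q) = z := mul_div_cancel₀ z hq0
  have hfz : (fun k => p k (y / q) z) = mulLin b f := by
    funext k
    have h := hC2 k (y / q) (z / q)
    rw [hz] at h
    simp only [mulLin, hf, hb]
    linear_combination h
  have hyz : (fun k => p k y z) = fun k => q ^ k * mulLin a f k := by
    funext k
    have h := contiguity_scale hq0 hp_neg hp_zero hC1 hC2 hC3 k (y / q) (z / q)
    rwa [hy, hz] at h
  have hyqz : (fun k => p k y (q * z)) = fun k => q ^ k * mulLin a (mulLin b f) k := by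
    funext k
    have h := contiguity_scale hq0 hp_neg hp_zero hC1 hC2 hC3 k (y / q) z
    rwa [hy, hfz] at h
  have s1 (m : ℕ) : phiAux p m (y / q) (z / q) = stairDet f m := rfl
  have s2 (m : ℕ) : phiAux p m (y / q) z = stairDet (mulLin b f) m := by
    rw [← hfz]
    rfl
  have s3 (m : ℕ) : phiAux p m y z =
      (∏ i : Fin m, q ^ ((m : ℤ) - ((i : ℕ) : ℤ))) * stairDet (mulLin a f) m := by
    rw [← stairDet_scale hq0, ← hyz]
    rfl
  have s4 (m : ℕ) : phiAux p m y (q * z) =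
      (∏ i : Fin m, q ^ ((m : ℤ) - ((i : ℕ) : ℤ))) * stairDet (mulLin a (mulLin b f)) m := by
    rw [← stairDet_scale hq0, ← hyqz]
    rfl
  have hba : b = -z * a := by
    rw [ha, hb]
    ring
  have ha0 : a ≠ 0 := div_ne_zero (neg_ne_zero.mpr (sub_ne_zero.mpr hq1.symm)) hq0
  have h1 := stairDet_bilinear hneg a b n
  have h2 := stairDet_bilinear_dual hneg a b n
  simp only [s1, s2, s3, s4, prod_zpow_sub_succ]
  set Q := ∏ i : Fin n, q ^ ((n : ℤ) - ((i : ℕ) : ℤ))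
  constructor
  · refine mul_left_cancel₀ ha0 ?_
    linear_combination (q ^ (n + 1) * Q) * h1 +
      q ^ (n + 1) * Q * (stairDet (mulLin a f) n * stairDet (mulLin b f) (n + 1) -
        stairDet f n * stairDet (mulLin a (mulLin b f)) (n + 1)) * hba
  · refine mul_left_cancel₀ ha0 ?_
    linear_combination (-(q ^ (n + 1)) * Q) * h2 +
      q ^ (n + 1) * Q * (stairDet (mulLin b f) n * stairDet (mulLin a f) (n + 1) -
        stairDet f (n + 1) * stairDet (mulLin a (mulLin b f)) n) * hba

theorem phi_natCast {K : Type*} [Field K] (p : ℤ → K → K → K) (n : ℕ) (y z : K) :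
    phi p (n : ℤ) y z = phiAux p n y z := by
  simp [phi]

theorem phi_neg_sub_one {K : Type*} [Field K] (p : ℤ → K → K → K) (n : ℕ) (y z : K) :
    phi p (-(n : ℤ) - 1) y z =
      (-1 : K) ^ ((-(n : ℤ) - 1) * (-(n : ℤ) - 1 + 1) / 2) * phiAux p n y z := by
  rw [phi, if_neg (by omega)]
  congr 2
  omega

/-- The bilinear relations behind the multiplicative formulas, for all integers `N`. -/
theorem phi_bilinear {K : Type*} [Field K] {q : K} (hq0 : q ≠ 0) (hq1 : q ≠ 1)
    {p : ℤ → K → K → K}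
    (hp_neg : ∀ k : ℤ, k < 0 → ∀ y z : K, p k y z = 0)
    (hp_zero : ∀ y z : K, p 0 y z = 1)
    (hC1 : ∀ k : ℕ, 1 ≤ k → ∀ y z : K,
      (∑ i ∈ Finset.range k, q ^ i) * p (k : ℤ) y z
        = (y + z + q ^ (k - 1)) * p ((k : ℤ) - 1) y z
          - (1 - q) * y * z * p ((k : ℤ) - 2) y z)
    (hC2 : ∀ (k : ℤ) (y z : K), p k y (q * z) - p k y z = (q - 1) * z * p (k - 1) y z)
    (hC3 : ∀ (k : ℤ) (y z : K), p k (q * y) z - p k y z = (q - 1) * y * p (k - 1) y z)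
    (N : ℤ) (y z : K) :
    phi p (N - 1) (y / q) z * phi p N y z +
        z * q ^ N * phi p (N - 1) y z * phi p N (y / q) z =
      (1 + z) * phi p (N - 1) (y / q) (z / q) * phi p N y (q * z) ∧
    z * phi p (N - 1) (y / q) z * phi p N y z +
        q ^ N * phi p (N - 1) y z * phi p N (y / q) z =
      q ^ N * (1 + z) * phi p (N - 1) y (q * z) * phi p N (y / q) (z / q) := by
  have hmain := fun n : ℕ => phiAux_bilinear hq0 hq1 hp_neg hp_zero hC1 hC2 hC3 n y z
  rcases lt_trichotomy N 0 with hN | rfl | hN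
  · obtain ⟨m, rfl⟩ : ∃ m : ℕ, N = -(m : ℤ) - 1 := ⟨(-N - 1).toNat, by omega⟩
    obtain ⟨hA, hB⟩ := hmain m
    have hpow : q ^ (-(m : ℤ) - 1) = (q ^ (m + 1))⁻¹ := by
      rw [← zpow_natCast, ← _root_.zpow_neg]
      congr 1
      push_cast
      ring
    have hQ : q ^ (m + 1) ≠ 0 := pow_ne_zero _ hq0
    rw [show -(m : ℤ) - 1 - 1 = -((m + 1 : ℕ) : ℤ) - 1 by push_cast; ring, hpow]
    simp only [phi_neg_sub_one]
    generalize (-1 : K) ^ ((-((m + 1 : ℕ) : ℤ) - 1) * (-((m + 1 : ℕ) : ℤ) - 1 + 1) / 2) = s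
    generalize (-1 : K) ^ ((-(m : ℤ) - 1) * (-(m : ℤ) - 1 + 1) / 2) = t
    generalize q ^ (m + 1) = Q at hA hB hQ ⊢
    generalize q * z = x at hA hB ⊢
    constructor
    · field_simp
      linear_combination s * t * hB
    · field_simp
      linear_combination s * t * hA
  · have h0 (u v : K) : phi p 0 u v = 1 := by simp [phi, phiAux]
    have h1 (u v : K) : phi p (0 - 1) u v = 1 := by simp [phi, phiAux]
    simp only [h0, h1, zpow_zero]
    constructor <;> ring
  · obtain ⟨n, rfl⟩ : ∃ n : ℕ, N = ((n + 1 : ℕ) : ℤ) := ⟨(N - 1).toNat, by omega⟩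
    rw [show ((n + 1 : ℕ) : ℤ) - 1 = (n : ℤ) by push_cast; ring, zpow_natCast]
    simp only [phi_natCast]
    exact hmain n

theorem multiplicative_formula_F0
    {K : Type*} [Field K] (q : K) (hq0 : q ≠ 0)
    (hq1 : ∀ k : ℕ, 1 ≤ k → q ^ k ≠ 1)
    (p : ℤ → K → K → K)
    (hp_neg : ∀ k : ℤ, k < 0 → ∀ y z : K, p k y z = 0)
    (hp_zero : ∀ y z : K, p 0 y z = 1)
    (hC1 : ∀ k : ℕ, 1 ≤ k → ∀ y z : K,
      (∑ i ∈ Finset.range k, q ^ i) * p (k : ℤ) y z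
        = (y + z + q ^ (k - 1)) * p ((k : ℤ) - 1) y z
          - (1 - q) * y * z * p ((k : ℤ) - 2) y z)
    (hC2 : ∀ (k : ℤ) (y z : K), p k y (q * z) - p k y z = (q - 1) * z * p (k - 1) y z)
    (hC3 : ∀ (k : ℤ) (y z : K), p k (q * y) z - p k y z = (q - 1) * y * p (k - 1) y z)
    (N : ℤ) (y z : K) (hz : z ≠ 0)
    (h1 : phi p (N - 1) (y / q) z ≠ 0) (h2 : phi p N y z ≠ 0)
    (F0 : K)
    (hF0 : F0 = q ^ N * phi p (N - 1) y z * phi p N (y / q) z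
      / (phi p (N - 1) (y / q) z * phi p N y z)) :
    1 + z * F0 = (1 + z) * phi p (N - 1) (y / q) (z / q) * phi p N y (q * z)
      / (phi p (N - 1) (y / q) z * phi p N y z) ∧
    1 + 1 / z * F0 = q ^ N * (1 + 1 / z) * phi p (N - 1) y (q * z) * phi p N (y / q) (z / q)
      / (phi p (N - 1) (y / q) z * phi p N y z) := by
  obtain ⟨hA, hB⟩ :=
    phi_bilinear hq0 (by simpa using hq1 1 le_rfl) hp_neg hp_zero hC1 hC2 hC3 N y z
  subst hF0
  generalize q * z = x at hA hB ⊢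
  constructor
  · field_simp
    linear_combination hA
  · field_simp
    linear_combination hB
end
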